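/- arXiv:2504.03477 — 10 statements merged into one kernel-verified Lean document; each statement's English description precedes it below -/
import Mathlib

section
/- Let PN = (P, T, Pre, Post) be a Petri net and let f ∈ F⁺ be a nonzero semiflow with nonnegative coordinates. Then the support ‖f‖ of f is both a siphon and a trap of PN. -/
/-- If a nonnegative weighting `f` gives `v` and `w` the same total weight and the support of `f`
meets that of `v`, then it also meets that of `w`. -/
theorem exists_ne_zero_of_weighted_sum_eq {P : Type*} [Fintype P] {f : P → ℤ} {v w : P → ℕ}
    (hf : ∀ p, 0 ≤ f p) (h : ∑ p, f p * (v p : ℤ) = ∑ p, f p * (w p : ℤ))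
    {p : P} (hp : f p ≠ 0) (hv : v p ≠ 0) : ∃ q, f q ≠ 0 ∧ w q ≠ 0 := by
  have hpos : 0 < ∑ p, f p * (v p : ℤ) :=
    Finset.sum_pos' (fun q _ => mul_nonneg (hf q) (Int.natCast_nonneg _))
      ⟨p, Finset.mem_univ p,
        mul_pos ((hf p).lt_of_ne' hp) (Int.natCast_pos.mpr (Nat.pos_of_ne_zero hv))⟩
  obtain ⟨q, -, hq⟩ := Finset.exists_ne_zero_of_sum_ne_zero (h ▸ hpos.ne')
  exact ⟨q, left_ne_zero_of_mul hq, Nat.cast_ne_zero.mp (right_ne_zero_of_mul hq)⟩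

/-- For a Petri net `(P, T, Pre, Post)` and a nonzero semiflow `f`
with nonnegative coordinates, the support of `f` is both a siphon and a trap. -/
theorem support_of_nonneg_semiflow_is_siphon_and_trap
    {P T : Type*} [Fintype P] [Fintype T]
    (Pre Post : P → T → ℕ) (f : P → ℤ)
    (hsemi : ∀ t : T, ∑ p, f p * (Post p t : ℤ) = ∑ p, f p * (Pre p t : ℤ))
    (hnonneg : ∀ p, 0 ≤ f p) (hne : f ≠ 0) :
    (∀ t : T, ∀ p, f p ≠ 0 → Post p t ≠ 0 → ∃ p', f p' ≠ 0 ∧ Pre p' t ≠ 0) ∧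
    (∀ t : T, ∀ p, f p ≠ 0 → Pre p t ≠ 0 → ∃ p', f p' ≠ 0 ∧ Post p' t ≠ 0) := by
  exact ⟨fun t _ => exists_ne_zero_of_weighted_sum_eq hnonneg (hsemi t),
    fun t _ => exists_ne_zero_of_weighted_sum_eq hnonneg (hsemi t).symm⟩
end

section
/- Let PN be a Petri net, q0 a marking, and f ∈ ℤ^P a semiflow. Then the positive support ‖f‖₊ = {p ∈ P | f(p) > 0} is bounded in ⟨PN,q0⟩ if and only if the negative support ‖f‖₋ = {p ∈ P | f(p) < 0} is bounded in ⟨PN,q0⟩. -/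
namespace PetriNetFormal

variable {P T : Type*}

/-- The marking obtained by firing transition `t` at marking `q`. -/
def fire (Pre Post : P → T → ℕ) (t : T) (q : P → ℕ) : P → ℕ :=
  fun p => q p - Pre p t + Post p t

/-- Transition `t` is enabled at marking `q`. -/
def enabled (Pre : P → T → ℕ) (q : P → ℕ) (t : T) : Prop :=
  ∀ p, Pre p t ≤ q p

/-- One firing step between markings. -/
def step (Pre Post : P → T → ℕ) (q q' : P → ℕ) : Prop :=
  ∃ t, enabled Pre q t ∧ q' = fire Pre Post t q

/-- Reachability: `q'` is obtained from `q` by firing a finite sequence of transitions. -/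
def reach (Pre Post : P → T → ℕ) : (P → ℕ) → (P → ℕ) → Prop :=
  Relation.ReflTransGen (step Pre Post)

/-- A set `A` of places is bounded in `⟨PN,q0⟩`. -/
def boundedSet [Fintype P] (Pre Post : P → T → ℕ) (q0 : P → ℕ) (A : Set P) : Prop :=
  ∀ p ∈ A, ∃ k : ℕ, ∀ q : P → ℕ, reach Pre Post q0 q → q p ≤ k

/-- The weighted token count given by a semiflow is constant on the reachability set. -/
theorem sum_semiflow_eq_of_reach [Fintype P] {Pre Post : P → T → ℕ} {q0 q : P → ℕ} {f : P → ℤ}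
    (hsemi : ∀ t : T, ∑ p, f p * (Post p t : ℤ) = ∑ p, f p * (Pre p t : ℤ))
    (h : reach Pre Post q0 q) :
    ∑ p, f p * (q p : ℤ) = ∑ p, f p * (q0 p : ℤ) := by
  induction h with
  | refl => rfl
  | @tail q₁ _ _ hstep ih =>
    obtain ⟨t, ht, rfl⟩ := hstep
    have key : ∀ p, f p * (fire Pre Post t q₁ p : ℤ) =
        f p * (q₁ p : ℤ) - f p * (Pre p t : ℤ) + f p * (Post p t : ℤ) := by
      intro p
      simp only [fire, Nat.cast_add, Nat.cast_sub (ht p)]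
      ring
    simp only [key, Finset.sum_add_distrib, Finset.sum_sub_distrib, hsemi t, ih]
    ring

theorem neg_support_bounded_of_pos_support_bounded [Fintype P]
    {Pre Post : P → T → ℕ} {q0 : P → ℕ} {f : P → ℤ}
    (hsemi : ∀ t : T, ∑ p, f p * (Post p t : ℤ) = ∑ p, f p * (Pre p t : ℤ))
    (hpos : boundedSet Pre Post q0 {p | 0 < f p}) :
    boundedSet Pre Post q0 {p | f p < 0} := by
  classical
  intro p₀ hp₀
  have hp₀ : f p₀ < 0 := hp₀
  have hbound : ∀ p, ∃ k : ℕ, 0 < f p → ∀ q, reach Pre Post q0 q → q p ≤ k := by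
    intro p
    by_cases hp : 0 < f p
    · obtain ⟨k, hk⟩ := hpos p hp
      exact ⟨k, fun _ => hk⟩
    · exact ⟨0, fun h => absurd h hp⟩
  choose k hk using hbound
  refine ⟨(∑ p, |f p| * (k p : ℤ) - ∑ p, f p * (q0 p : ℤ)).toNat, fun q hq => ?_⟩
  have hterm : ∀ p, f p * (q p : ℤ) + (if p = p₀ then (q p : ℤ) else 0) ≤ |f p| * (k p : ℤ) := by
    intro p
    have habs : 0 ≤ |f p| * (k p : ℤ) := by positivity
    have hq0 : (0 : ℤ) ≤ q p := by positivity
    split_ifs with h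
    · subst h
      nlinarith
    · rcases lt_or_ge 0 (f p) with hp | hp
      · have hle : (q p : ℤ) ≤ k p := by exact_mod_cast hk p hp q hq
        rw [abs_of_pos hp, add_zero]
        gcongr
      · nlinarith
  have hsum := Finset.sum_le_sum fun p (_ : p ∈ Finset.univ) => hterm p
  rw [Finset.sum_add_distrib, sum_semiflow_eq_of_reach hsemi hq, Finset.sum_ite_eq'] at hsum
  simp only [Finset.mem_univ, if_true] at hsum
  omega

/-- For a semiflow `f`, the positive support `‖f‖₊` is bounded in
`⟨PN,q0⟩` iff the negative support `‖f‖₋` is bounded in `⟨PN,q0⟩`. -/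
theorem pos_support_bounded_iff_neg_support_bounded [Fintype P]
    (Pre Post : P → T → ℕ) (q0 : P → ℕ) (f : P → ℤ)
    (hsemi : ∀ t : T, ∑ p, f p * (Post p t : ℤ) = ∑ p, f p * (Pre p t : ℤ)) :
    boundedSet Pre Post q0 {p | 0 < f p} ↔ boundedSet Pre Post q0 {p | f p < 0} := by
  refine ⟨neg_support_bounded_of_pos_support_bounded hsemi, fun hneg => ?_⟩
  have h := neg_support_bounded_of_pos_support_bounded (Pre := Pre) (Post := Post) (q0 := q0)
    (f := -f) (by simpa using hsemi) (by simpa using hneg)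
  simpa using h

end PetriNetFormal
end

section
/- Let PN be a Petri net and f : P → ℕ a vector satisfying fᵀPost(·,t) ≤ fᵀPre(·,t) for all t ∈ T. Then: (1) the support ‖f‖ is structurally bounded, i.e., bounded in ⟨PN,q0⟩ for every initial marking q0; (2) if f ≠ 0 then ‖f‖ is a siphon; (3) for every marking q0, every p ∈ ‖f‖, and every q ∈ RS(PN,q0), one has q(p) ≤ ⌊fᵀq0 / f(p)⌋. -/
namespace PetriNetFormal

variable {P T : Type*}

/-- Firing an enabled transition does not increase a weighting that decreases along it. -/
theorem sum_mul_fire_le [Fintype P] {Pre Post : P → T → ℕ} {f q : P → ℕ} {t : T}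
    (hineq : ∑ p, f p * Post p t ≤ ∑ p, f p * Pre p t) (ht : enabled Pre q t) :
    ∑ p, f p * fire Pre Post t q p ≤ ∑ p, f p * q p := by
  have h : ∑ p, f p * fire Pre Post t q p + ∑ p, f p * Pre p t
      = ∑ p, f p * q p + ∑ p, f p * Post p t := by
    rw [← Finset.sum_add_distrib, ← Finset.sum_add_distrib]
    refine Finset.sum_congr rfl fun p _ => ?_
    have hp := ht p
    rw [← mul_add, ← mul_add, fire]
    congr 1
    omega
  omega

/-- A decreasing weighting does not increase along reachability. -/
theorem reach.sum_mul_le [Fintype P] {Pre Post : P → T → ℕ} {f q0 q : P → ℕ}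
    (hineq : ∀ t : T, ∑ p, f p * Post p t ≤ ∑ p, f p * Pre p t)
    (h : reach Pre Post q0 q) : ∑ p, f p * q p ≤ ∑ p, f p * q0 p := by
  induction h with
  | refl => exact le_rfl
  | tail _ hs ih =>
    obtain ⟨t, ht, rfl⟩ := hs
    exact (sum_mul_fire_le (hineq t) ht).trans ih

/-- if `f : P → ℕ` satisfies `fᵀPost(·,t) ≤ fᵀPre(·,t)` for all `t`, then
(1) `‖f‖` is structurally bounded; (2) if `f ≠ 0` then `‖f‖` is a siphon;
(3) for every `q0`, `p ∈ ‖f‖`, and reachable `q`, `q(p) ≤ ⌊fᵀq0 / f(p)⌋`. -/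
theorem decreasing_weighting_bounded_siphon_and_bound [Fintype P]
    (Pre Post : P → T → ℕ) (f : P → ℕ)
    (hineq : ∀ t : T, ∑ p, f p * Post p t ≤ ∑ p, f p * Pre p t) :
    (∀ q0 : P → ℕ, ∀ p, f p ≠ 0 → ∃ k : ℕ, ∀ q : P → ℕ, reach Pre Post q0 q → q p ≤ k) ∧
    (f ≠ 0 → ∀ t : T, ∀ p, f p ≠ 0 → Post p t ≠ 0 → ∃ p', f p' ≠ 0 ∧ Pre p' t ≠ 0) ∧
    (∀ q0 : P → ℕ, ∀ p, f p ≠ 0 → ∀ q : P → ℕ, reach Pre Post q0 q →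
      q p ≤ (∑ p', f p' * q0 p') / f p) := by
  have bound : ∀ q0 : P → ℕ, ∀ p, f p ≠ 0 → ∀ q : P → ℕ, reach Pre Post q0 q →
      q p ≤ (∑ p', f p' * q0 p') / f p := by
    intro q0 p hp q hq
    rw [Nat.le_div_iff_mul_le (Nat.pos_of_ne_zero hp), mul_comm]
    exact (Finset.single_le_sum (f := fun p => f p * q p) (fun _ _ => Nat.zero_le _)
      (Finset.mem_univ p)).trans (reach.sum_mul_le hineq hq)
  refine ⟨fun q0 p hp => ⟨_, bound q0 p hp⟩, fun _ t p hp hpost => ?_, bound⟩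
  by_contra! hpre
  have hzero : ∑ p, f p * Pre p t = 0 := Finset.sum_eq_zero fun p' _ => by
    by_cases h : f p' = 0
    · rw [h, zero_mul]
    · rw [hpre p' h, mul_zero]
  have hle := (Finset.single_le_sum (f := fun p => f p * Post p t) (fun _ _ => Nat.zero_le _)
    (Finset.mem_univ p)).trans (hineq t)
  rw [hzero] at hle
  exact mul_ne_zero hp hpost (Nat.le_zero.mp hle)

end PetriNetFormal
end

section
/- (Johnen) Let PN be a Petri net and Init a nonempty set of markings such that RS(PN,Init) is finite. A set H of markings is an Init-home space if and only if S ∩ H ≠ ∅ for every strongly connected component sink S of RG(PN,Init). -/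
namespace PetriNetFormal

variable {P T : Type*}

/-- The reachability set from a set `Init` of initial markings. -/
def RS (Pre Post : P → T → ℕ) (Init : Set (P → ℕ)) : Set (P → ℕ) :=
  {q | ∃ a ∈ Init, reach Pre Post a q}

/-- `H` is an `Init`-home space. -/
def homeSpace (Pre Post : P → T → ℕ) (Init H : Set (P → ℕ)) : Prop :=
  ∀ q ∈ RS Pre Post Init, ∃ h ∈ H, reach Pre Post q h

/-- `s` is an `Init`-home state. -/
def homeState (Pre Post : P → T → ℕ) (Init : Set (P → ℕ)) (s : P → ℕ) : Prop :=
  homeSpace Pre Post Init {s}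

/-- `S` is a strongly connected component sink of `RG(PN,Init)`: an equivalence class
of the mutual-reachability relation on `RS(PN,Init)` that is closed under reachability. -/
def sccSink (Pre Post : P → T → ℕ) (Init : Set (P → ℕ)) (S : Set (P → ℕ)) : Prop :=
  (∃ x ∈ RS Pre Post Init,
    S = {y ∈ RS Pre Post Init | reach Pre Post x y ∧ reach Pre Post y x}) ∧
  (∀ y ∈ S, ∀ z, reach Pre Post y z → z ∈ S)

/-- Transition `t` is live in `⟨PN, Init⟩`. -/
def live (Pre Post : P → T → ℕ) (Init : Set (P → ℕ)) (t : T) : Prop :=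
  ∀ q ∈ RS Pre Post Init, ∃ q', reach Pre Post q q' ∧ enabled Pre q' t

/-- A point with finitely many successors under a reflexive transitive closure reaches a point
that can be reached back from each of its own successors. -/
theorem exists_reachable_recurrent {α : Type*} {r : α → α → Prop} {q : α}
    (hfin : {y | Relation.ReflTransGen r q y}.Finite) :
    ∃ x, Relation.ReflTransGen r q x ∧
      ∀ y, Relation.ReflTransGen r x y → Relation.ReflTransGen r y x := by
  obtain ⟨x, hqx, hmin⟩ := Set.exists_min_image _
    (fun x => {y | Relation.ReflTransGen r x y}.ncard) hfin ⟨q, .refl⟩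
  refine ⟨x, hqx, fun y hxy => ?_⟩
  have hsub : {z | Relation.ReflTransGen r y z} ⊆ {z | Relation.ReflTransGen r x z} :=
    fun z hyz => hxy.trans hyz
  have heq := Set.eq_of_subset_of_ncard_le hsub (hmin y (hqx.trans hxy))
    (hfin.subset fun z hxz => hqx.trans hxz)
  have hx : x ∈ {z | Relation.ReflTransGen r x z} := .refl
  rwa [← heq] at hx

theorem mem_RS_of_reach {Pre Post : P → T → ℕ} {Init : Set (P → ℕ)} {q q' : P → ℕ}
    (hq : q ∈ RS Pre Post Init) (h : reach Pre Post q q') : q' ∈ RS Pre Post Init := by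
  obtain ⟨a, ha, haq⟩ := hq
  exact ⟨a, ha, haq.trans h⟩

/-- Johnen: if `RS(PN,Init)` is finite and `Init` nonempty, then `H` is an
`Init`-home space iff `H` meets every strongly connected component sink of `RG(PN,Init)`. -/
theorem johnen
    (Pre Post : P → T → ℕ) (Init : Set (P → ℕ)) (hInit : Init.Nonempty)
    (hfin : (RS Pre Post Init).Finite) (H : Set (P → ℕ)) :
    homeSpace Pre Post Init H ↔
      ∀ S : Set (P → ℕ), sccSink Pre Post Init S → (S ∩ H).Nonempty := by
  constructor
  · rintro hH S ⟨⟨x, hx, rfl⟩, hclosed⟩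
    obtain ⟨h, hhH, hxh⟩ := hH x hx
    exact ⟨h, hclosed x ⟨hx, .refl, .refl⟩ h hxh, hhH⟩
  · intro hS q hq
    obtain ⟨x, hqx, hrec⟩ := exists_reachable_recurrent (r := step Pre Post) (q := q)
      (hfin.subset fun y hqy => mem_RS_of_reach hq hqy)
    have hx := mem_RS_of_reach hq hqx
    obtain ⟨h, ⟨-, hxh, -⟩, hhH⟩ := hS _ ⟨⟨x, hx, rfl⟩, fun y hy z hyz =>
      have hxz := hy.2.1.trans hyz
      ⟨mem_RS_of_reach hx hxz, hxz, hrec z hxz⟩⟩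
    exact ⟨h, hhH, hqx.trans hxh⟩

end PetriNetFormal
end

section
/- Let PN be a Petri net, Init a nonempty set of markings, and q an Init-home state. Then every transition enabled at q is live in ⟨PN,Init⟩, and more generally a transition t is live in ⟨PN,Init⟩ if and only if some marking in RS(PN,q) enables t. -/
namespace PetriNetFormal

variable {P T : Type*}

/-- A home state is reachable from every reachable marking. -/
theorem homeState.reach_of_mem_RS {Pre Post : P → T → ℕ} {Init : Set (P → ℕ)} {s x : P → ℕ}
    (hs : homeState Pre Post Init s) (hx : x ∈ RS Pre Post Init) : reach Pre Post x s := by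
  obtain ⟨_, rfl, h⟩ := hs x hx
  exact h

/-- A home state of a nonempty set of initial markings is itself reachable. -/
theorem homeState.mem_RS {Pre Post : P → T → ℕ} {Init : Set (P → ℕ)} {s : P → ℕ}
    (hs : homeState Pre Post Init s) (hInit : Init.Nonempty) : s ∈ RS Pre Post Init := by
  obtain ⟨a, ha⟩ := hInit
  exact ⟨a, ha, hs.reach_of_mem_RS ⟨a, ha, Relation.ReflTransGen.refl⟩⟩

/-- A transition enabled at some marking reachable from a home state is live. -/
theorem homeState.live_of_reach {Pre Post : P → T → ℕ} {Init : Set (P → ℕ)} {s s' : P → ℕ} {t : T}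
    (hs : homeState Pre Post Init s) (hss' : reach Pre Post s s') (ht : enabled Pre s' t) :
    live Pre Post Init t :=
  fun _ hx => ⟨s', (hs.reach_of_mem_RS hx).trans hss', ht⟩

/-- if `q` is an `Init`-home state, then every transition enabled at `q`
is live in `⟨PN,Init⟩`; more generally, `t` is live iff some marking reachable
from `q` enables `t`. -/
theorem home_state_liveness
    (Pre Post : P → T → ℕ) (Init : Set (P → ℕ)) (hInit : Init.Nonempty)
    (q : P → ℕ) (hq : homeState Pre Post Init q) :
    (∀ t : T, enabled Pre q t → live Pre Post Init t) ∧
    (∀ t : T, live Pre Post Init t ↔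
      ∃ q', reach Pre Post q q' ∧ enabled Pre q' t) := by
  refine ⟨fun t ht => hq.live_of_reach Relation.ReflTransGen.refl ht, fun t => ⟨fun h => ?_, ?_⟩⟩
  · exact h q (hq.mem_RS hInit)
  · rintro ⟨q', hqq', ht⟩
    exact hq.live_of_reach hqq' ht

end PetriNetFormal
end

section
/- (Gordan) Let PN be a Petri net and let F⁺ be the set of vectors f ∈ ℕ^P satisfying fᵀPost(·,t) = fᵀPre(·,t) for all t ∈ T. Then there exists a finite subset E ⊆ F⁺ such that every f ∈ F⁺ can be written as a finite linear combination of elements of E with coefficients in ℕ. -/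
namespace PetriNetFormal

variable {P T : Type*}

/-- `F⁺`: the set of vectors `f ∈ ℕ^P` with `fᵀPost(·,t) = fᵀPre(·,t)` for all `t`,
i.e. the semiflows with nonnegative coordinates. -/
def Fplus [Fintype P] (Pre Post : P → T → ℕ) : Set (P → ℕ) :=
  {f | ∀ t : T, ∑ p, f p * Post p t = ∑ p, f p * Pre p t}

/-- `F⁺` as an `ℕ`-submodule of `P → ℕ`. -/
def FplusSubmodule [Fintype P] (Pre Post : P → T → ℕ) : Submodule ℕ (P → ℕ) :=
  LinearMap.eqLocus (Matrix.vecMulLinear (Matrix.of Post)) (Matrix.vecMulLinear (Matrix.of Pre))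

theorem mem_FplusSubmodule [Fintype P] {Pre Post : P → T → ℕ} {f : P → ℕ} :
    f ∈ FplusSubmodule Pre Post ↔ f ∈ Fplus Pre Post :=
  funext_iff

theorem FplusSubmodule_fg [Fintype P] (Pre Post : P → T → ℕ) : (FplusSubmodule Pre Post).FG :=
  (Submodule.fg_iff_addSubmonoid_fg _).2 <| AddSubmonoid.fg_eqLocusM
    (Matrix.vecMulLinear (Matrix.of Post)).toAddMonoidHom
    (Matrix.vecMulLinear (Matrix.of Pre)).toAddMonoidHom

/-- Gordan: there is a finite subset `E ⊆ F⁺` such that every `f ∈ F⁺`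
is an ℕ-linear combination of elements of `E`. -/
theorem gordan [Fintype P] [DecidableEq P] (Pre Post : P → T → ℕ) :
    ∃ E : Finset (P → ℕ), (↑E ⊆ Fplus Pre Post) ∧
      ∀ f ∈ Fplus Pre Post, ∃ c : (P → ℕ) → ℕ,
        f = fun p => ∑ e ∈ E, c e * e p := by
  obtain ⟨E, hE⟩ := FplusSubmodule_fg Pre Post
  refine ⟨E, fun e he => mem_FplusSubmodule.1 (hE ▸ Submodule.subset_span he), fun f hf => ?_⟩
  rw [← mem_FplusSubmodule, ← hE, Submodule.mem_span_finset] at hf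
  obtain ⟨c, -, rfl⟩ := hf
  exact ⟨c, by ext p; simp⟩

end PetriNetFormal
end

section
/- Let PN be a Petri net. A nonzero semiflow f ∈ F⁺ is minimal if and only if f belongs to every generating set of F⁺ over ℕ. Moreover, the set of minimal semiflows of F⁺ is finite and is a generating set of F⁺ over ℕ. -/
namespace PetriNetFormal

variable {P T : Type*}

/-- `G` is a generating set of `F⁺` over ℕ. -/
def genSetN [Fintype P] [DecidableEq P] (Pre Post : P → T → ℕ) (G : Set (P → ℕ)) : Prop :=
  G ⊆ Fplus Pre Post ∧
  ∀ f ∈ Fplus Pre Post, ∃ E : Finset (P → ℕ), (↑E ⊆ G) ∧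
    ∃ c : (P → ℕ) → ℕ, f = fun p => ∑ e ∈ E, c e * e p

/-- `f` is a minimal (nonzero) semiflow of `F⁺` for the componentwise order. -/
def minSemiflow [Fintype P] (Pre Post : P → T → ℕ) (f : P → ℕ) : Prop :=
  f ∈ Fplus Pre Post ∧ f ≠ 0 ∧
  ¬ ∃ g ∈ Fplus Pre Post, g ≠ 0 ∧ g ≠ f ∧ g ≤ f

/-- Truncated difference of nonnegative semiflows `g ≤ f` is again a nonnegative semiflow. -/
lemma sub_mem_Fplus [Fintype P] {Pre Post : P → T → ℕ} {f g : P → ℕ}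
    (hf : f ∈ Fplus Pre Post) (hg : g ∈ Fplus Pre Post) (hgf : g ≤ f) :
    f - g ∈ Fplus Pre Post := by
  intro t
  have split (w : P → ℕ) : ∑ p, (f - g) p * w p + ∑ p, g p * w p = ∑ p, f p * w p := by
    rw [← Finset.sum_add_distrib]
    refine Finset.sum_congr rfl fun p _ => ?_
    rw [← add_mul, Pi.sub_apply, Nat.sub_add_cancel (hgf p)]
  have hPost := split (Post · t)
  have hPre := split (Pre · t)
  have := hf t
  have := hg t
  lia

/-- The minimal semiflows form an antichain in `ℕ^P`, hence a finite set (Dickson's lemma). -/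
lemma finite_setOf_minSemiflow [Fintype P] (Pre Post : P → T → ℕ) :
    {f | minSemiflow Pre Post f}.Finite := by
  refine WellQuasiOrderedLE.finite_of_isAntichain fun f hf g hg hne hle => ?_
  exact hg.2.2 ⟨f, hf.1, hf.2.1, hne, hle⟩

lemma exists_eq_sum_minSemiflow [Fintype P] {Pre Post : P → T → ℕ} {E : Finset (P → ℕ)}
    (hE : ∀ e, minSemiflow Pre Post e → e ∈ E) (f : P → ℕ) (hf : f ∈ Fplus Pre Post) :
    ∃ c : (P → ℕ) → ℕ, f = fun p => ∑ e ∈ E, c e * e p := by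
  classical
  induction f using WellFoundedLT.induction with
  | ind f ih =>
    by_cases h0 : f = 0
    · exact ⟨0, by ext; simp [h0]⟩
    by_cases hmin : minSemiflow Pre Post f
    · exact ⟨Pi.single f 1, by ext; simp [Pi.single_apply, hE f hmin]⟩
    obtain ⟨g, hg, hg0, hgf, hle⟩ : ∃ g ∈ Fplus Pre Post, g ≠ 0 ∧ g ≠ f ∧ g ≤ f := by
      by_contra h
      exact hmin ⟨hf, h0, h⟩
    have hlt : f - g < f := by
      refine lt_of_le_of_ne (fun p => Nat.sub_le _ _) fun h => hg0 ?_
      ext p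
      have := congrFun h p
      have := hle p
      simp only [Pi.sub_apply, Pi.zero_apply] at *
      lia
    obtain ⟨c, hc⟩ := ih g (lt_of_le_of_ne hle hgf) hg
    obtain ⟨d, hd⟩ := ih (f - g) hlt (sub_mem_Fplus hf hg hle)
    refine ⟨c + d, funext fun p => ?_⟩
    have hcp := congrFun hc p
    have hdp := congrFun hd p
    have := hle p
    simp only [Pi.add_apply, add_mul, Finset.sum_add_distrib, Pi.sub_apply] at *
    lia

lemma genSetN_minSemiflow [Fintype P] [DecidableEq P] (Pre Post : P → T → ℕ) :
    genSetN Pre Post {f | minSemiflow Pre Post f} := by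
  have hfin := finite_setOf_minSemiflow Pre Post
  exact ⟨fun _ hf => hf.1, fun f hf => ⟨hfin.toFinset, by simp,
    exists_eq_sum_minSemiflow (fun e he => hfin.mem_toFinset.2 he) f hf⟩⟩

lemma minSemiflow.mem_of_genSetN [Fintype P] [DecidableEq P] {Pre Post : P → T → ℕ}
    {f : P → ℕ} (hf : minSemiflow Pre Post f) {G : Set (P → ℕ)} (hG : genSetN Pre Post G) :
    f ∈ G := by
  obtain ⟨E, hEG, c, hc⟩ := hG.2 f hf.1
  obtain ⟨p, hp⟩ := Function.ne_iff.1 hf.2.1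
  rw [hc] at hp
  obtain ⟨e, he, hne⟩ := Finset.exists_ne_zero_of_sum_ne_zero hp
  obtain ⟨hce, hep⟩ := mul_ne_zero_iff.1 hne
  have hle : e ≤ f := fun q => by
    rw [hc]
    exact (Nat.le_mul_of_pos_left _ (Nat.pos_of_ne_zero hce)).trans
      (Finset.single_le_sum (f := fun e => c e * e q) (fun _ _ => Nat.zero_le _) he)
  by_contra hfG
  refine hf.2.2 ⟨e, hG.1 (hEG he), fun h => hep (congrFun h p), ?_, hle⟩
  rintro rfl
  exact hfG (hEG he)

/-- Decomposition over ℕ: a nonzero semiflow of `F⁺` is minimal iff it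
belongs to every generating set over ℕ; moreover the set of minimal semiflows is
finite and is a generating set over ℕ. -/
theorem minimal_semiflows_generate [Fintype P] [DecidableEq P]
    (Pre Post : P → T → ℕ) :
    (∀ f ∈ Fplus Pre Post, f ≠ 0 →
      (minSemiflow Pre Post f ↔
        ∀ G : Set (P → ℕ), genSetN Pre Post G → f ∈ G)) ∧
    {f | minSemiflow Pre Post f}.Finite ∧
    genSetN Pre Post {f | minSemiflow Pre Post f} := by
  have hgen := genSetN_minSemiflow Pre Post
  exact ⟨fun f _ _ => ⟨fun hf _ hG => hf.mem_of_genSetN hG, fun h => h _ hgen⟩,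
    finite_setOf_minSemiflow Pre Post, hgen⟩

end PetriNetFormal
end

section
/- Let PN be a Petri net and let I ⊆ P be a minimal support of semiflows in F⁺. Then there exists a unique minimal semiflow f ∈ F⁺ with ‖f‖ = I, and every g ∈ F⁺ with ‖g‖ = I satisfies g = k·f for some positive integer k. Consequently, for any nonzero g ∈ F⁺ with ‖g‖ = I, every h ∈ F⁺ with ‖h‖ = I can be written h = α·g for some α ∈ ℚ with α > 0. -/
namespace PetriNetFormal

variable {P T : Type*}

/-- The support of a vector. -/
def supp (f : P → ℕ) : Set P := {p | f p ≠ 0}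

/-- `I` is a minimal support of semiflows of `F⁺`. -/
def minSupport [Fintype P] (Pre Post : P → T → ℕ) (I : Set P) : Prop :=
  (∃ f ∈ Fplus Pre Post, f ≠ 0 ∧ supp f = I) ∧
  ¬ ∃ g ∈ Fplus Pre Post, g ≠ 0 ∧ supp g ⊂ I

theorem Fplus_tsub_mem [Fintype P] {Pre Post : P → T → ℕ} {f g : P → ℕ}
    (hf : f ∈ Fplus Pre Post) (hg : g ∈ Fplus Pre Post) (hle : f ≤ g) :
    g - f ∈ Fplus Pre Post := by
  intro t
  have add_sub (w : P → ℕ) : ∑ p, (g - f) p * w p + ∑ p, f p * w p = ∑ p, g p * w p := by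
    rw [← Finset.sum_add_distrib]
    refine Finset.sum_congr rfl fun p _ => ?_
    rw [← add_mul, Pi.sub_apply, Nat.sub_add_cancel (hle p)]
  have hPost := add_sub (Post · t)
  have hPre := add_sub (Pre · t)
  have hft := hf t
  have hgt := hg t
  omega

theorem Fplus_smul_mem [Fintype P] {Pre Post : P → T → ℕ} {f : P → ℕ}
    (hf : f ∈ Fplus Pre Post) (k : ℕ) : k • f ∈ Fplus Pre Post := by
  intro t
  simp only [Pi.smul_apply, smul_eq_mul, mul_assoc, ← Finset.mul_sum, hf t]

theorem supp_nonempty {f : P → ℕ} (hf : f ≠ 0) : (supp f).Nonempty :=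
  Function.ne_iff.mp hf

theorem supp_eq_of_subset [Fintype P] {Pre Post : P → T → ℕ} {I : Set P}
    (hI : minSupport Pre Post I) {f : P → ℕ} (hf : f ∈ Fplus Pre Post) (hne : f ≠ 0)
    (hsub : supp f ⊆ I) : supp f = I := by
  by_contra h
  exact hI.2 ⟨f, hf, hne, hsub.ssubset_of_ne h⟩

theorem minSupport.nonempty [Fintype P] {Pre Post : P → T → ℕ} {I : Set P}
    (hI : minSupport Pre Post I) : I.Nonempty := by
  obtain ⟨f, -, hne, rfl⟩ := hI.1
  exact supp_nonempty hne

/-- Two semiflows with the same minimal support are proportional. -/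
theorem exists_proportional [Fintype P] {Pre Post : P → T → ℕ} {I : Set P}
    (hI : minSupport Pre Post I) {f g : P → ℕ} (hf : f ∈ Fplus Pre Post)
    (hg : g ∈ Fplus Pre Post) (hfI : supp f = I) (hgI : supp g = I) :
    ∃ p ∈ I, ∀ q, f p * g q = g p * f q := by
  obtain ⟨p, hp, hmin⟩ :=
    Set.exists_min_image I (fun p => (g p : ℚ) / f p) (Set.toFinite I) hI.nonempty
  have f_pos {q : P} (hq : q ∈ I) : 0 < f q := Nat.pos_of_ne_zero (by rwa [← hfI] at hq)
  have eq_zero {q : P} (hq : q ∉ I) : f q = 0 ∧ g q = 0 :=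
    ⟨by rw [← hfI] at hq; exact not_not.mp hq, by rw [← hgI] at hq; exact not_not.mp hq⟩
  have hle : g p • f ≤ f p • g := by
    intro q
    by_cases hq : q ∈ I
    · have h := hmin q hq
      have hfp : (0 : ℚ) < f p := mod_cast f_pos hp
      have hfq : (0 : ℚ) < f q := mod_cast f_pos hq
      rw [div_le_div_iff₀ hfp hfq] at h
      simp only [Pi.smul_apply, smul_eq_mul]
      rw [mul_comm (f p)]
      exact_mod_cast h
    · simp [eq_zero hq]
  have hmem := Fplus_tsub_mem (Fplus_smul_mem hf (g p)) (Fplus_smul_mem hg (f p)) hle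
  have hsub : supp (f p • g - g p • f) ⊆ I := by
    intro q hq
    by_contra hqI
    exact hq (by simp [eq_zero hqI])
  have hzero : f p • g - g p • f = 0 := by
    by_contra hne
    have hp' : p ∈ supp (f p • g - g p • f) := by
      rwa [supp_eq_of_subset hI hmem hne hsub]
    exact hp' (by simp [mul_comm])
  exact ⟨p, hp, fun q => le_antisymm (tsub_eq_zero_iff_le.mp hzero q) (hle q)⟩

/-- A minimal semiflow generates all semiflows supported in its minimal support. -/
theorem exists_eq_smul_of_supp_subset [Fintype P] {Pre Post : P → T → ℕ} {I : Set P}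
    (hI : minSupport Pre Post I) {f : P → ℕ} (hf : minSemiflow Pre Post f)
    (hfI : supp f = I) (g : P → ℕ) (hg : g ∈ Fplus Pre Post) (hgI : supp g ⊆ I) :
    ∃ k : ℕ, g = k • f := by
  induction g using WellFoundedLT.induction with
  | ind g ih =>
    by_cases hg0 : g = 0
    · exact ⟨0, by simp [hg0]⟩
    obtain ⟨p, hp, hprop⟩ :=
      exists_proportional hI hf.1 hg hfI (supp_eq_of_subset hI hg hg0 hgI)
    have hfp : 0 < f p := Nat.pos_of_ne_zero (by rwa [← hfI] at hp)
    have hfg : f ≤ g := by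
      rcases le_total (f p) (g p) with h | h
      · intro q
        refine Nat.le_of_mul_le_mul_left ?_ hfp
        rw [hprop q]
        exact Nat.mul_le_mul_right _ h
      · have hgf : g ≤ f := by
          intro q
          refine Nat.le_of_mul_le_mul_left ?_ hfp
          rw [hprop q]
          exact Nat.mul_le_mul_right _ h
        by_contra hle
        exact hf.2.2 ⟨g, hg, hg0, fun h => hle h.ge, hgf⟩
    have hlt : g - f < g := by
      refine lt_of_le_of_ne tsub_le_self fun h => ?_
      have hsub : g p - f p = g p := congrFun h p
      have hle : f p ≤ g p := hfg p
      omega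
    have hsub : supp (g - f) ⊆ I := by
      intro q hq
      refine hgI fun h => hq ?_
      simp [h]
    obtain ⟨k, hk⟩ := ih (g - f) hlt (Fplus_tsub_mem hf.1 hg hfg) hsub
    exact ⟨k + 1, by rw [add_smul, one_smul, ← hk, tsub_add_cancel_of_le hfg]⟩

theorem exists_pos_eq_smul [Fintype P] {Pre Post : P → T → ℕ} {I : Set P}
    (hI : minSupport Pre Post I) {f : P → ℕ} (hf : minSemiflow Pre Post f)
    (hfI : supp f = I) {g : P → ℕ} (hg : g ∈ Fplus Pre Post) (hgI : supp g = I) :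
    ∃ k : ℕ, 0 < k ∧ g = k • f := by
  obtain ⟨k, hk⟩ := exists_eq_smul_of_supp_subset hI hf hfI g hg hgI.subset
  refine ⟨k, Nat.pos_of_ne_zero fun hk0 => ?_, hk⟩
  obtain ⟨p, hp⟩ := hI.nonempty
  rw [← hgI] at hp
  exact hp (by simp [hk, hk0])

theorem exists_minSemiflow [Fintype P] {Pre Post : P → T → ℕ} {I : Set P}
    (hI : minSupport Pre Post I) : ∃ f, minSemiflow Pre Post f ∧ supp f = I := by
  obtain ⟨f₀, hf₀, hne₀, hf₀I⟩ := hI.1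
  obtain ⟨f, ⟨hf, hne, hfI⟩, hmin⟩ := wellFounded_lt.has_min
    {f | f ∈ Fplus Pre Post ∧ f ≠ 0 ∧ supp f = I} ⟨f₀, hf₀, hne₀, hf₀I⟩
  refine ⟨f, ⟨hf, hne, ?_⟩, hfI⟩
  rintro ⟨g, hg, hg0, hgf, hle⟩
  have hsub : supp g ⊆ I := by
    intro q hq
    rw [← hfI]
    exact fun h => hq (Nat.le_zero.mp (h ▸ hle q))
  exact hmin g ⟨hg, hg0, supp_eq_of_subset hI hg hg0 hsub⟩ (lt_of_le_of_ne hle hgf)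

/-- Minimal support: if `I` is a minimal support then there is a unique
minimal semiflow `f` with `‖f‖ = I`; every `g ∈ F⁺` with `‖g‖ = I` is a positive
integer multiple of `f`; consequently any two nonzero semiflows of support `I` are
positive rational multiples of one another. -/
theorem minimal_support_unique_semiflow [Fintype P]
    (Pre Post : P → T → ℕ) (I : Set P) (hI : minSupport Pre Post I) :
    (∃! f : P → ℕ, minSemiflow Pre Post f ∧ supp f = I) ∧
    (∀ f : P → ℕ, minSemiflow Pre Post f → supp f = I →
      ∀ g ∈ Fplus Pre Post, supp g = I →
        ∃ k : ℕ, 0 < k ∧ g = fun p => k * f p) ∧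
    (∀ g ∈ Fplus Pre Post, g ≠ 0 → supp g = I →
      ∀ h ∈ Fplus Pre Post, supp h = I →
        ∃ α : ℚ, 0 < α ∧ ∀ p, (h p : ℚ) = α * (g p : ℚ)) := by
  refine ⟨?_, fun f hf hfI g hg hgI => exists_pos_eq_smul hI hf hfI hg hgI, ?_⟩
  · obtain ⟨f, hf, hfI⟩ := exists_minSemiflow hI
    refine ⟨f, ⟨hf, hfI⟩, ?_⟩
    rintro g ⟨hg, hgI⟩
    obtain ⟨k, hk, rfl⟩ := exists_pos_eq_smul hI hf hfI hg.1 hgI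
    by_contra hne
    exact hg.2.2 ⟨f, hf.1, hf.2.1, Ne.symm hne, fun p => Nat.le_mul_of_pos_left _ hk⟩
  · intro g hg _ hgI h hh hhI
    obtain ⟨p, hp, hprop⟩ := exists_proportional hI hg hh hgI hhI
    have hgp : (0 : ℚ) < g p := mod_cast Nat.pos_of_ne_zero (by rwa [← hgI] at hp)
    have hhp : (0 : ℚ) < h p := mod_cast Nat.pos_of_ne_zero (by rwa [← hhI] at hp)
    refine ⟨h p / g p, div_pos hhp hgp, fun q => ?_⟩
    have hq : (g p : ℚ) * h q = h p * g q := mod_cast hprop q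
    field_simp
    linarith

end PetriNetFormal
end

section
/- Let PN be a Petri net and let I be the support of some semiflow in F⁺. Let I_1, …, I_N be all the minimal supports of semiflows contained in I (there are finitely many). Then I = I_1 ∪ … ∪ I_N. Moreover, for every f ∈ F⁺ with ‖f‖ ⊆ I, there exist nonnegative rationals α_1, …, α_N and semiflows g_1, …, g_N ∈ F⁺ with ‖g_i‖ = I_i such that f = Σ_{i=1}^{N} α_i g_i (as vectors in ℚ^P). -/
namespace PetriNetFormal

variable {P T : Type*}

/-- Eliminating a coordinate: if `‖g‖ ⊆ ‖f‖` and `g ≠ 0`, some combination `g(q) f - f(q) g`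
is a semiflow of `F⁺` whose support is strictly smaller than that of `f`. -/
theorem exists_smaller_support [Fintype P] {Pre Post : P → T → ℕ} {f g : P → ℕ}
    (hf : f ∈ Fplus Pre Post) (hg : g ∈ Fplus Pre Post) (hg0 : g ≠ 0)
    (hgf : supp g ⊆ supp f) :
    ∃ q, g q ≠ 0 ∧ ∃ h ∈ Fplus Pre Post, supp h ⊂ supp f ∧
      ∀ p, g q * f p = h p + f q * g p := by
  classical
  obtain ⟨p₀, hp₀⟩ := Function.ne_iff.mp hg0
  obtain ⟨q, hq, hmin⟩ := Finset.exists_min_image (Finset.univ.filter fun p => g p ≠ 0)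
    (fun p => (f p : ℚ) / g p) ⟨p₀, by simpa using hp₀⟩
  have hgq : g q ≠ 0 := by simpa using hq
  have hle : ∀ p, f q * g p ≤ g q * f p := by
    intro p
    by_cases hp : g p = 0
    · simp [hp]
    have key := hmin p (by simpa using hp)
    rw [div_le_div_iff₀ (by positivity) (by positivity)] at key
    have key' : f q * g p ≤ f p * g q := by exact_mod_cast key
    linarith
  have heq : ∀ p, g q * f p = (g q * f p - f q * g p) + f q * g p := fun p =>
    (Nat.sub_add_cancel (hle p)).symm
  refine ⟨q, hgq, fun p => g q * f p - f q * g p, fun t => ?_, ?_, heq⟩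
  · have expand : ∀ W : P → T → ℕ, g q * ∑ p, f p * W p t =
        ∑ p, (g q * f p - f q * g p) * W p t + f q * ∑ p, g p * W p t := by
      intro W
      rw [Finset.mul_sum, Finset.mul_sum, ← Finset.sum_add_distrib]
      refine Finset.sum_congr rfl fun p _ => ?_
      rw [← mul_assoc, ← mul_assoc, ← add_mul, ← heq p]
    have hPost := expand Post
    rw [hf t, hg t, expand Pre] at hPost
    exact (Nat.add_right_cancel hPost).symm
  · have hsub : supp (fun p => g q * f p - f q * g p) ⊆ supp f := fun p hp hfp =>
      hp (by simp [hfp])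
    exact (Set.ssubset_iff_of_subset hsub).mpr
      ⟨q, hgf hgq, fun hq' => hq' (by simp [mul_comm])⟩

/-- If every nonzero semiflow of `F⁺` supported in `I` has a support containing that of some
member of the family `g`, then the family generates these semiflows over `ℚ⁺`. -/
theorem exists_nonneg_combination [Fintype P] {ι : Type*} [Fintype ι] {Pre Post : P → T → ℕ}
    {I : Set P} {g : ι → P → ℕ} (hg : ∀ i, g i ∈ Fplus Pre Post) (hg0 : ∀ i, g i ≠ 0)
    (hI : ∀ f ∈ Fplus Pre Post, f ≠ 0 → supp f ⊆ I → ∃ i, supp (g i) ⊆ supp f)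
    {f : P → ℕ} (hf : f ∈ Fplus Pre Post) (hfI : supp f ⊆ I) :
    ∃ α : ι → ℚ, (∀ i, 0 ≤ α i) ∧ ∀ p, (f p : ℚ) = ∑ i, α i * (g i p : ℚ) := by
  classical
  induction hS : supp f using WellFoundedLT.induction generalizing f with
  | ind S ih =>
    subst hS
    by_cases hf0 : f = 0
    · exact ⟨0, fun _ => le_rfl, fun p => by simp [hf0]⟩
    obtain ⟨i, hi⟩ := hI f hf hf0 hfI
    obtain ⟨q, hq, h, hh, hlt, heq⟩ := exists_smaller_support hf (hg i) (hg0 i) hi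
    obtain ⟨β, hβ, hsum⟩ := ih _ hlt hh (hlt.subset.trans hfI) rfl
    refine ⟨fun j => (β j + (Pi.single i (f q : ℚ) : ι → ℚ) j) / g i q, fun j => ?_, fun p => ?_⟩
    · have : (0 : ι → ℚ) ≤ Pi.single i (f q : ℚ) := Pi.single_nonneg.mpr (Nat.cast_nonneg _)
      exact div_nonneg (add_nonneg (hβ j) (this j)) (Nat.cast_nonneg _)
    · have hq' : (g i q : ℚ) ≠ 0 := Nat.cast_ne_zero.mpr hq
      have hp : (g i q : ℚ) * f p = h p + f q * g i p := by exact_mod_cast heq p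
      have hsingle : ∑ j, (Pi.single i (f q : ℚ) : ι → ℚ) j * (g j p : ℚ) = f q * g i p := by
        simp [Pi.single_apply]
      simp_rw [div_mul_eq_mul_div, add_mul]
      rw [← Finset.sum_div, Finset.sum_add_distrib, hsingle, ← hsum p, ← hp]
      field_simp

/-- The support of a nonzero semiflow of `F⁺` contains a minimal support. -/
theorem exists_minSupport_subset [Fintype P] {Pre Post : P → T → ℕ} {f : P → ℕ}
    (hf : f ∈ Fplus Pre Post) (hf0 : f ≠ 0) :
    ∃ J, minSupport Pre Post J ∧ J ⊆ supp f := by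
  induction hS : supp f using WellFoundedLT.induction generalizing f with
  | ind S ih =>
    subst hS
    by_cases hmin : ∃ g ∈ Fplus Pre Post, g ≠ 0 ∧ supp g ⊂ supp f
    · obtain ⟨g, hg, hg0, hlt⟩ := hmin
      obtain ⟨J, hJ, hJg⟩ := ih _ hlt hg hg0 rfl
      exact ⟨J, hJ, hJg.trans hlt.subset⟩
    · exact ⟨supp f, ⟨⟨f, hf, hf0, rfl⟩, hmin⟩, subset_rfl⟩

/-- Decomposition over ℚ⁺: let `I` be the support of a semiflow of `F⁺`.
The minimal supports contained in `I` can be enumerated as `I_1, …, I_N` (finitely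
many, all distinct); their union is `I`; and every `f ∈ F⁺` with `‖f‖ ⊆ I` is a
nonnegative rational combination of semiflows `g_i` with `‖g_i‖ = I_i`. -/
theorem decomposition_over_minimal_supports [Fintype P]
    (Pre Post : P → T → ℕ) (I : Set P)
    (hI : ∃ f ∈ Fplus Pre Post, supp f = I) :
    ∃ (N : ℕ) (Is : Fin N → Set P),
      Function.Injective Is ∧
      (∀ i, minSupport Pre Post (Is i) ∧ Is i ⊆ I) ∧
      (∀ J : Set P, minSupport Pre Post J → J ⊆ I → ∃ i, Is i = J) ∧
      I = ⋃ i, Is i ∧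
      (∀ f ∈ Fplus Pre Post, supp f ⊆ I →
        ∃ (α : Fin N → ℚ) (g : Fin N → (P → ℕ)),
          (∀ i, 0 ≤ α i ∧ g i ∈ Fplus Pre Post ∧ supp (g i) = Is i) ∧
          ∀ p, (f p : ℚ) = ∑ i, α i * (g i p : ℚ)) := by
  obtain ⟨N, ⟨e⟩⟩ := Finite.exists_equiv_fin {J : Set P // minSupport Pre Post J ∧ J ⊆ I}
  let Is : Fin N → Set P := fun i => (e.symm i).1
  have hIs : ∀ i, minSupport Pre Post (Is i) ∧ Is i ⊆ I := fun i => (e.symm i).2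
  have hall : ∀ J : Set P, minSupport Pre Post J → J ⊆ I → ∃ i, Is i = J := fun J hJ hJI =>
    ⟨e ⟨J, hJ, hJI⟩, by simp [Is]⟩
  choose g hg hg0 hgs using fun i => (hIs i).1.1
  have hgen : ∀ f ∈ Fplus Pre Post, f ≠ 0 → supp f ⊆ I → ∃ i, supp (g i) ⊆ supp f := by
    intro f hf hf0 hfI
    obtain ⟨J, hJ, hJf⟩ := exists_minSupport_subset hf hf0
    obtain ⟨i, rfl⟩ := hall J hJ (hJf.trans hfI)
    exact ⟨i, (hgs i).trans_subset hJf⟩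
  refine ⟨N, Is, Subtype.val_injective.comp e.symm.injective, hIs, hall, ?_, ?_⟩
  · refine Set.Subset.antisymm (fun p hp => ?_) (Set.iUnion_subset fun i => (hIs i).2)
    obtain ⟨f, hf, rfl⟩ := hI
    obtain ⟨α, -, hsum⟩ := exists_nonneg_combination hg hg0 hgen hf subset_rfl
    have hne : ∑ i, α i * (g i p : ℚ) ≠ 0 := by
      rw [← hsum p]
      exact Nat.cast_ne_zero.mpr hp
    obtain ⟨i, -, hi⟩ := Finset.exists_ne_zero_of_sum_ne_zero hne
    refine Set.mem_iUnion.mpr ⟨i, hgs i ▸ ?_⟩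
    exact Nat.cast_ne_zero.mp (right_ne_zero_of_mul hi)
  · intro f hf hfI
    obtain ⟨α, hα, hsum⟩ := exists_nonneg_combination hg hg0 hgen hf hfI
    exact ⟨α, g, fun i => ⟨hα i, hg i, hgs i⟩, hsum⟩

end PetriNetFormal
end

section
/- Let PN be a Petri net, q0 a marking, and E = {e_1, …, e_N} any finite generating set of F⁺ over ℚ⁺. Then: (i) ⋂_{f ∈ F⁺} H(f,q0) = ⋂_{i=1}^{N} H(e_i,q0); (ii) for every place p and every f ∈ F⁺ with f(p) ≠ 0, min_{{ i | e_i(p) ≠ 0 }} (e_iᵀq0 / e_i(p)) ≤ fᵀq0 / f(p) (so the infimum over F⁺ of these ratios is attained on E); (iii) for every transition t and every f ∈ F⁺ with fᵀPre(·,t) ≠ 0, min_{{ i | e_iᵀPre(·,t) ≠ 0 }} (e_iᵀq0 / e_iᵀPre(·,t)) ≤ fᵀq0 / fᵀPre(·,t). -/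
namespace PetriNetFormal

variable {P T : Type*}

/-- `H(f,q)` : the set of markings having the same `f`-weighted token count as `q`. -/
def Hset [Fintype P] (f : P → ℕ) (q : P → ℕ) : Set (P → ℕ) :=
  {q' : P → ℕ | ∑ p, f p * q' p = ∑ p, f p * q p}

/-- Mediant inequality: a ratio of nonnegative combinations dominates one of the ratios. -/
theorem exists_div_le_sum_div_sum {ι : Type*} [Fintype ι] (α a b : ι → ℚ)
    (hα : ∀ i, 0 ≤ α i) (ha : ∀ i, 0 ≤ a i) (hb : ∀ i, 0 ≤ b i)
    (hB : ∑ i, α i * b i ≠ 0) :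
    ∃ i, b i ≠ 0 ∧ a i / b i ≤ (∑ i, α i * a i) / ∑ i, α i * b i := by
  by_contra! h
  obtain ⟨j, -, hj⟩ := Finset.exists_ne_zero_of_sum_ne_zero hB
  have hBpos : 0 < ∑ i, α i * b i :=
    (Finset.sum_nonneg fun i _ => mul_nonneg (hα i) (hb i)).lt_of_ne' hB
  set A := ∑ i, α i * a i with hA
  set B := ∑ i, α i * b i with hBdef
  have hlt : ∀ i, b i ≠ 0 → A * b i < a i * B := fun i hi =>
    (div_lt_div_iff₀ hBpos ((hb i).lt_of_ne' hi)).1 (h i hi)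
  have hle : ∀ i, A * b i ≤ a i * B := fun i => by
    by_cases hi : b i = 0
    · simpa [hi] using mul_nonneg (ha i) hBpos.le
    · exact (hlt i hi).le
  have hsum : ∑ i, α i * (A * b i) < ∑ i, α i * (a i * B) :=
    Finset.sum_lt_sum (fun i _ => mul_le_mul_of_nonneg_left (hle i) (hα i))
      ⟨j, Finset.mem_univ j, mul_lt_mul_of_pos_left (hlt j (right_ne_zero_of_mul hj))
        ((hα j).lt_of_ne' (left_ne_zero_of_mul hj))⟩
  have hl : ∑ i, α i * (A * b i) = A * B := by
    rw [hBdef, Finset.mul_sum]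
    exact Finset.sum_congr rfl fun i _ => by ring
  have hr : ∑ i, α i * (a i * B) = A * B := by
    rw [hA, Finset.sum_mul]
    exact Finset.sum_congr rfl fun i _ => by ring
  exact absurd hsum (by rw [hl, hr]; exact lt_irrefl _)

/-- The weighted sum of a linear combination is the combination of the weighted sums. -/
theorem sum_mul_of_eq_combination {ι : Type*} [Fintype ι] [Fintype P] {f : P → ℕ}
    {e : ι → P → ℕ} {α : ι → ℚ} (h : ∀ p, (f p : ℚ) = ∑ i, α i * (e i p : ℚ)) (w : P → ℕ) :
    ∑ p, (f p : ℚ) * (w p : ℚ) = ∑ i, α i * ∑ p, (e i p : ℚ) * (w p : ℚ) := by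
  simp_rw [h, Finset.sum_mul, Finset.mul_sum, mul_assoc]
  exact Finset.sum_comm

/-- given any finite generating set `E = {e_1,…,e_N}` of `F⁺` over ℚ⁺:
(i) `⋂_{f ∈ F⁺} H(f,q0) = ⋂_i H(e_i,q0)`;
(ii) for each place `p`, the minimum of `e_iᵀq0 / e_i(p)` over the `e_i` with
`e_i(p) ≠ 0` is a lower bound of `fᵀq0 / f(p)` over all `f ∈ F⁺` with `f(p) ≠ 0`;
(iii) similarly for the enabling-threshold ratios `fᵀq0 / fᵀPre(·,t)`. -/
theorem extremums_computable_from_generating_set [Fintype P]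
    (Pre Post : P → T → ℕ) (q0 : P → ℕ)
    (N : ℕ) (e : Fin N → (P → ℕ))
    (heF : ∀ i, e i ∈ Fplus Pre Post)
    (hgen : ∀ f ∈ Fplus Pre Post, ∃ α : Fin N → ℚ, (∀ i, 0 ≤ α i) ∧
      ∀ p, (f p : ℚ) = ∑ i, α i * (e i p : ℚ)) :
    ((⋂ f ∈ Fplus Pre Post, Hset f q0) = ⋂ i, Hset (e i) q0) ∧
    (∀ p : P, ∀ f ∈ Fplus Pre Post, f p ≠ 0 →
      ∃ i, e i p ≠ 0 ∧
        (∑ p', (e i p' : ℚ) * (q0 p' : ℚ)) / (e i p : ℚ) ≤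
          (∑ p', (f p' : ℚ) * (q0 p' : ℚ)) / (f p : ℚ)) ∧
    (∀ t : T, ∀ f ∈ Fplus Pre Post,
      (∑ p, (f p : ℚ) * (Pre p t : ℚ)) ≠ 0 →
      ∃ i, (∑ p, (e i p : ℚ) * (Pre p t : ℚ)) ≠ 0 ∧
        (∑ p', (e i p' : ℚ) * (q0 p' : ℚ)) / (∑ p, (e i p : ℚ) * (Pre p t : ℚ)) ≤
          (∑ p', (f p' : ℚ) * (q0 p' : ℚ)) / (∑ p, (f p : ℚ) * (Pre p t : ℚ))) := by
  have hnn : ∀ (w : P → ℕ) (i : Fin N), 0 ≤ ∑ p, (e i p : ℚ) * (w p : ℚ) := fun w i =>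
    Finset.sum_nonneg fun p _ => by positivity
  refine ⟨?_, fun p f hf hp => ?_, fun t f hf ht => ?_⟩
  · refine Set.Subset.antisymm
      (Set.subset_iInter fun i => Set.biInter_subset_of_mem (heF i)) ?_
    refine fun q hq => Set.mem_iInter₂.2 fun f hf => ?_
    obtain ⟨α, -, h⟩ := hgen f hf
    have hqe : ∀ i, ∑ p, (e i p : ℚ) * (q p : ℚ) = ∑ p, (e i p : ℚ) * (q0 p : ℚ) := fun i =>
      mod_cast (Set.mem_iInter.1 hq i : ∑ p, e i p * q p = ∑ p, e i p * q0 p)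
    have hqf : ∑ p, (f p : ℚ) * (q p : ℚ) = ∑ p, (f p : ℚ) * (q0 p : ℚ) := by
      simp_rw [sum_mul_of_eq_combination h, hqe]
    exact (mod_cast hqf : ∑ p, f p * q p = ∑ p, f p * q0 p)
  · obtain ⟨α, hα, h⟩ := hgen f hf
    have hp' : ∑ i, α i * (e i p : ℚ) ≠ 0 := by
      rw [← h p]
      exact_mod_cast hp
    obtain ⟨i, hi, hle⟩ := exists_div_le_sum_div_sum α _ (fun i => (e i p : ℚ)) hα (hnn q0)
      (fun i => Nat.cast_nonneg _) hp'
    refine ⟨i, mod_cast hi, ?_⟩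
    rwa [sum_mul_of_eq_combination h, h p]
  · obtain ⟨α, hα, h⟩ := hgen f hf
    rw [sum_mul_of_eq_combination h fun p => Pre p t] at ht ⊢
    rw [sum_mul_of_eq_combination h]
    exact exists_div_le_sum_div_sum α _ _ hα (hnn q0) (hnn fun p => Pre p t) ht

end PetriNetFormal
end
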